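/- Suppose T(𝓛) contains at least one type 1 toggle. Then for every type 2 toggle τ and every pair of blocks 𝓑, 𝓒 of the fixed block system, the restriction of τ to 𝓑 has the same cycle structure as the restriction of τ to 𝓒; precisely, there exists a bijection f : 𝓑 → 𝓒 such that f(τ(A)) = τ(f(A)) for all A ∈ 𝓑. -/

import Mathlib

open scoped symmDiff

namespace TogglePaper

variable {E : Type*} [DecidableEq E]

/-- The toggle `τ_e` on the collection `L` of subsets of the ground set. -/
def toggle (L : Finset (Finset E)) (e : E) : Equiv.Perm {A : Finset E // A ∈ L} :=
  Function.Involutive.toPerm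
    (fun X => if h : X.1 ∆ ({e} : Finset E) ∈ L then ⟨X.1 ∆ ({e} : Finset E), h⟩ else X)
    (by
      intro X
      by_cases h : X.1 ∆ ({e} : Finset E) ∈ L
      · have h2 : (X.1 ∆ ({e} : Finset E)) ∆ ({e} : Finset E) = X.1 :=
          symmDiff_symmDiff_cancel_right _ _
        simp only [dif_pos h, h2]
        simp [h2, X.2]
      · simp [h])

/-- The generalized toggle group `T(L)`. -/
def toggleGroup (L : Finset (Finset E)) : Subgroup (Equiv.Perm {A : Finset E // A ∈ L}) :=
  Subgroup.closure (Set.range (toggle L))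

/-- `T(L)` acts transitively on `L`. -/
def IsTransitive (L : Finset (Finset E)) : Prop :=
  ∀ A B : {A : Finset E // A ∈ L}, ∃ g ∈ toggleGroup L, g A = B

/-- `B` is a block for the action of `T(L)` on `L`. -/
def IsBlock (L : Finset (Finset E)) (B : Finset {A : Finset E // A ∈ L}) : Prop :=
  ∀ g ∈ toggleGroup L, Finset.image g B = B ∨ Disjoint (Finset.image g B) B

/-- `Blocks` is a block system for `T(L)`: a partition of `L` into nonempty blocks
that is permuted by every element of `T(L)`. -/
def IsBlockSystem (L : Finset (Finset E))
    (Blocks : Finset (Finset {A : Finset E // A ∈ L})) : Prop :=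
  (∀ B ∈ Blocks, B.Nonempty) ∧
  (∀ A : {A : Finset E // A ∈ L}, ∃! B : Finset {A : Finset E // A ∈ L},
      B ∈ Blocks ∧ A ∈ B) ∧
  (∀ g ∈ toggleGroup L, ∀ B ∈ Blocks, Finset.image g B ∈ Blocks)

/-- An element `g` of `T(L)` is type 2 (with respect to a fixed block system `Blocks`)
if it maps each block to itself; it is type 1 otherwise. -/
def IsType2 (L : Finset (Finset E)) (Blocks : Finset (Finset {A : Finset E // A ∈ L}))
    (g : Equiv.Perm {A : Finset E // A ∈ L}) : Prop :=
  ∀ B ∈ Blocks, Finset.image g B = B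

/-- The action of `T(L)` on `L` is primitive: it is transitive and the only blocks
are the singletons, the empty set and the whole set. -/
def IsPrimitive (L : Finset (Finset E)) : Prop :=
  IsTransitive L ∧
    ∀ B : Finset {A : Finset E // A ∈ L}, IsBlock L B → B.card ≤ 1 ∨ B = Finset.univ

/-- `T(L)` contains a long cycle, i.e. a cycle whose support is all of `L`. -/
def HasLongCycle (L : Finset (Finset E)) : Prop :=
  ∃ g ∈ toggleGroup L, g.IsCycle ∧ g.support = Finset.univ

lemma toggle_apply_of_mem {L : Finset (Finset E)} {e : E} {X : {A : Finset E // A ∈ L}}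
    (h : X.1 ∆ ({e} : Finset E) ∈ L) : toggle L e X = ⟨X.1 ∆ ({e} : Finset E), h⟩ :=
  dif_pos h

lemma toggle_apply_of_notMem {L : Finset (Finset E)} {e : E} {X : {A : Finset E // A ∈ L}}
    (h : X.1 ∆ ({e} : Finset E) ∉ L) : toggle L e X = X :=
  dif_neg h

lemma toggle_toggle (L : Finset (Finset E)) (e : E) (X : {A : Finset E // A ∈ L}) :
    toggle L e (toggle L e X) = X :=
  Function.Involutive.toPerm_involutive _ X

lemma symmDiff_mem_of_toggle_ne {L : Finset (Finset E)} {e : E} {X : {A : Finset E // A ∈ L}}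
    (h : toggle L e X ≠ X) : X.1 ∆ ({e} : Finset E) ∈ L := by
  by_contra hX
  exact h (toggle_apply_of_notMem hX)

/-- Two toggles commute at `A` as soon as the second one moves `A`, `τ_x A` and `τ_x τ_y A`. -/
lemma toggle_comm_apply {L : Finset (Finset E)} {x y : E} {A : {A : Finset E // A ∈ L}}
    (hA : toggle L y A ≠ A) (hxA : toggle L y (toggle L x A) ≠ toggle L x A)
    (hxyA : toggle L y (toggle L x (toggle L y A)) ≠ toggle L x (toggle L y A)) :
    toggle L y (toggle L x A) = toggle L x (toggle L y A) := by
  have hy := symmDiff_mem_of_toggle_ne hA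
  have hyx := symmDiff_mem_of_toggle_ne hxA
  have hyxy := symmDiff_mem_of_toggle_ne hxyA
  rw [toggle_apply_of_mem hy] at hyxy ⊢
  by_cases hx : A.1 ∆ ({x} : Finset E) ∈ L
  · rw [toggle_apply_of_mem hx] at hyx ⊢
    have h : (A.1 ∆ ({y} : Finset E)) ∆ ({x} : Finset E) ∈ L := by
      rwa [symmDiff_right_comm]
    rw [toggle_apply_of_mem hyx, toggle_apply_of_mem h]
    exact Subtype.ext (symmDiff_right_comm _ _ _)
  · have h : (A.1 ∆ ({y} : Finset E)) ∆ ({x} : Finset E) ∉ L := by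
      intro h
      rw [toggle_apply_of_mem h] at hyxy
      apply hx
      rwa [symmDiff_right_comm, symmDiff_symmDiff_cancel_right] at hyxy
    rw [toggle_apply_of_notMem hx, toggle_apply_of_notMem (X := ⟨_, hy⟩) h, toggle_apply_of_mem hy]

lemma IsBlockSystem.eq_of_mem {L : Finset (Finset E)}
    {Blocks : Finset (Finset {A : Finset E // A ∈ L})} (hBS : IsBlockSystem L Blocks)
    {B C : Finset {A : Finset E // A ∈ L}} (hB : B ∈ Blocks) (hC : C ∈ Blocks)
    {A : {A : Finset E // A ∈ L}} (hAB : A ∈ B) (hAC : A ∈ C) : B = C :=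
  (hBS.2.1 A).unique ⟨hB, hAB⟩ ⟨hC, hAC⟩

lemma IsType2.apply_mem {L : Finset (Finset E)}
    {Blocks : Finset (Finset {A : Finset E // A ∈ L})}
    {g : Equiv.Perm {A : Finset E // A ∈ L}} (hg : IsType2 L Blocks g)
    {B : Finset {A : Finset E // A ∈ L}} (hB : B ∈ Blocks)
    {A : {A : Finset E // A ∈ L}} (hA : A ∈ B) : g A ∈ B :=
  hg B hB ▸ Finset.mem_image_of_mem g hA

lemma toggle_mem_toggleGroup (L : Finset (Finset E)) (e : E) : toggle L e ∈ toggleGroup L :=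
  Subgroup.subset_closure ⟨e, rfl⟩

lemma toggle_comm_apply_of_image_ne {L : Finset (Finset E)}
    {Blocks : Finset (Finset {A : Finset E // A ∈ L})} (hBS : IsBlockSystem L Blocks)
    {x y : E} (hx : IsType2 L Blocks (toggle L x))
    {B : Finset {A : Finset E // A ∈ L}} (hB : B ∈ Blocks) (hy : B.image (toggle L y) ≠ B)
    {A : {A : Finset E // A ∈ L}} (hA : A ∈ B) :
    toggle L y (toggle L x A) = toggle L x (toggle L y A) := by
  have hC := hBS.2.2 _ (toggle_mem_toggleGroup L y) B hB
  have hmove : ∀ X ∈ B, toggle L y X ≠ X := fun X hX h =>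
    hy (hBS.eq_of_mem hC hB (Finset.mem_image_of_mem _ hX) (h.symm ▸ hX))
  have hmove' : ∀ X ∈ B.image (toggle L y), toggle L y X ≠ X := by
    intro X hX
    obtain ⟨Y, hY, rfl⟩ := Finset.mem_image.1 hX
    rw [toggle_toggle]
    exact (hmove Y hY).symm
  exact toggle_comm_apply (hmove A hA) (hmove _ (hx.apply_mem hB hA))
    (hmove' _ (hx.apply_mem hC (Finset.mem_image_of_mem _ hA)))

/-- Every element of the toggle group carries a block to a block on which a given type 2 toggle
acts in the same way. -/
lemma exists_perm_image_eq_and_comm {L : Finset (Finset E)}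
    {Blocks : Finset (Finset {A : Finset E // A ∈ L})} (hBS : IsBlockSystem L Blocks)
    {x : E} (hx : IsType2 L Blocks (toggle L x))
    {g : Equiv.Perm {A : Finset E // A ∈ L}} (hg : g ∈ toggleGroup L) :
    ∀ B ∈ Blocks, ∃ h : Equiv.Perm {A : Finset E // A ∈ L},
      B.image h = B.image g ∧ ∀ A ∈ B, h (toggle L x A) = toggle L x (h A) := by
  induction hg using Subgroup.closure_induction with
  | mem g hg =>
    obtain ⟨y, rfl⟩ := hg
    intro B hB
    by_cases hy : B.image (toggle L y) = B
    · exact ⟨1, by simp [hy], fun _ _ => rfl⟩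
    · exact ⟨_, rfl, fun A hA => toggle_comm_apply_of_image_ne hBS hx hB hy hA⟩
  | one => exact fun B _ => ⟨1, rfl, fun _ _ => rfl⟩
  | mul g₁ g₂ _ hg₂ ih₁ ih₂ =>
    intro B hB
    obtain ⟨h₂, himg₂, hcomm₂⟩ := ih₂ B hB
    obtain ⟨h₁, himg₁, hcomm₁⟩ := ih₁ _ (hBS.2.2 g₂ hg₂ B hB)
    refine ⟨h₁ * h₂, ?_, fun A hA => ?_⟩
    · rw [Equiv.Perm.coe_mul, Equiv.Perm.coe_mul, ← Finset.image_image, ← Finset.image_image,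
        himg₂, himg₁]
    · rw [Equiv.Perm.mul_apply, Equiv.Perm.mul_apply, hcomm₂ A hA]
      exact hcomm₁ _ (himg₂ ▸ Finset.mem_image_of_mem h₂ hA)
  | inv g hg ih =>
    intro B hB
    have hC := hBS.2.2 g⁻¹ (inv_mem hg) B hB
    obtain ⟨h, himg, hcomm⟩ := ih _ hC
    have hgB : (B.image ⇑g⁻¹).image g = B := by
      rw [Finset.image_image, ← Equiv.Perm.coe_mul, mul_inv_cancel, Equiv.Perm.coe_one,
        Finset.image_id]
    rw [hgB] at himg
    have himg' : B.image ⇑h⁻¹ = B.image ⇑g⁻¹ := by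
      conv_lhs => rw [← himg]
      rw [Finset.image_image, ← Equiv.Perm.coe_mul, inv_mul_cancel, Equiv.Perm.coe_one,
        Finset.image_id]
    refine ⟨h⁻¹, himg', fun A hA => ?_⟩
    rw [Equiv.Perm.inv_eq_iff_eq, hcomm _ (himg' ▸ Finset.mem_image_of_mem _ hA)]
    exact congrArg _ (h.apply_symm_apply A).symm

/-- the restriction of a type 2 toggle to any block has the same
cycle structure as its restriction to any other block. -/
theorem type2_toggle_same_cycle_structure_on_blocks
    [Fintype E] (L : Finset (Finset E))
    (hnt : ∀ e : E, toggle L e ≠ 1)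
    (htrans : IsTransitive L)
    (Blocks : Finset (Finset {A : Finset E // A ∈ L}))
    (hBS : IsBlockSystem L Blocks)
    (hex : ∃ y : E, ¬ IsType2 L Blocks (toggle L y))
    (x : E) (hx : IsType2 L Blocks (toggle L x))
    (B C : Finset {A : Finset E // A ∈ L}) (hB : B ∈ Blocks) (hC : C ∈ Blocks) :
    ∃ f : {A : Finset E // A ∈ L} → {A : Finset E // A ∈ L},
      Set.BijOn f ↑B ↑C ∧ ∀ A ∈ B, f (toggle L x A) = toggle L x (f A) := by
  obtain ⟨A, hA⟩ := hBS.1 B hB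
  obtain ⟨D, hD⟩ := hBS.1 C hC
  obtain ⟨g, hg, hgA⟩ := htrans A D
  have hgB : B.image g = C :=
    hBS.eq_of_mem (hBS.2.2 g hg B hB) hC (Finset.mem_image_of_mem g hA) (hgA.symm ▸ hD)
  obtain ⟨h, himg, hcomm⟩ := exists_perm_image_eq_and_comm hBS hx hg B hB
  refine ⟨h, ?_, hcomm⟩
  rw [← hgB, ← himg, Finset.coe_image]
  exact h.injective.injOn.bijOn_image

end TogglePaper
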